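/- Let h, w ≥ 3 with h ≡ 0 (mod 3) and w ≡ 0 (mod 3), and let W : Fin h × Fin w → Bool have every filled cell with at most 2 filled orthogonal neighbors. Then the number of filled cells of W is at most 2hw/3 + 2. -/

import Mathlib

abbrev cellAdj {h w : ℕ} (p q : Fin h × Fin w) : Prop :=
  (p.1 = q.1 ∧ (p.2.val + 1 = q.2.val ∨ q.2.val + 1 = p.2.val)) ∨
  (p.2 = q.2 ∧ (p.1.val + 1 = q.1.val ∨ q.1.val + 1 = p.1.val))

/-- number of filled orthogonal neighbors of `p` -/
def degW {h w : ℕ} (W : Fin h × Fin w → Bool) (p : Fin h × Fin w) : ℕ :=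
  (Finset.univ.filter (fun q => cellAdj p q ∧ W q = true)).card

/-- every filled cell has at most `d` filled orthogonal neighbors -/
def degLEW {h w : ℕ} (W : Fin h × Fin w → Bool) (d : ℕ) : Prop :=
  ∀ p, W p = true → degW W p ≤ d

/-- number of filled cells -/
def filledCount {h w : ℕ} (W : Fin h × Fin w → Bool) : ℕ :=
  (Finset.univ.filter (fun p => W p = true)).card

/-- indicator of a filled cell -/
def bi (b : Bool) : ℤ := cond b 1 0

def bn (b : Bool) : ℕ := cond b 1 0

/-- numerical code of a pair of adjacent columns of height 3 -/
def code6 (a b c a' b' c' : Bool) : ℕ :=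
  8 * (bn a + 2 * bn b + 4 * bn c) + (bn a' + 2 * bn b' + 4 * bn c')

def potTable : List ℤ :=
  [0, 0, 0, 0, 0, 0, 0, 0, 0, 0, 0, 0, 0, 0, 0, 1, 0, 0, 0, 0, 0, 0, 0, 0, 1, 0, 2, 0, 2, 1, 3, 1,
   0, 0, 0, 0, 0, 0, 0, 0, 0, 1, 1, 2, 0, 1, 1, 2, 1, 2, 0, 0, 1, 2, 0, 0, 3, 1, 0, 0, 3, 1, 0, 0]

/-- the (antisymmetric) potential of a pair of adjacent columns of a boundary strip -/
def psi (a b c a' b' c' : Bool) : ℤ :=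
  potTable.getD (code6 a' b' c' a b c) 0 - potTable.getD (code6 a b c a' b' c') 0

theorem psi_anti (a b c a' b' c' : Bool) : psi a b c a' b' c' = - psi a' b' c' a b c := by
  unfold psi; ring

/-- cost of a cell with neighbours -/
def kk (v l r u d : Bool) : ℤ := 4 - 2 * bi v - bi l - bi r - bi u - bi d

def hh2 (v l r : Bool) : ℤ := (1 - bi v) * ((1 - bi l) + (1 - bi r))

/-- cost charged to the middle column of three columns of a boundary strip -/
def sCost (a0 b0 c0 a1 b1 c1 a2 b2 c2 : Bool) : ℤ :=
  kk a1 a0 a2 false b1 + kk b1 b0 b2 a1 c1 + (1 - bi a1) + hh2 c1 c0 c2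

theorem step_lemma : ∀ a0 b0 c0 a1 b1 c1 a2 b2 c2 : Bool,
    0 ≤ kk a1 a0 a2 false b1 → 0 ≤ kk b1 b0 b2 a1 c1 →
    psi a1 b1 c1 a2 b2 c2 - psi a0 b0 c0 a1 b1 c1 + 2 ≤
      2 * sCost a0 b0 c0 a1 b1 c1 a2 b2 c2 := by
  decide +kernel

/-- window rows `a`, `b`, `c`, corner cell `a0` -/
theorem corner_lemma : ∀ a0 a1 a2 b0 b1 b2 c0 c1 c2 : Bool,
    0 ≤ kk a0 false a1 false b0 → 0 ≤ kk a1 a0 a2 false b1 →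
    0 ≤ kk b0 false b1 a0 c0 → 0 ≤ kk b1 b0 b2 a1 c1 →
    2 + psi a1 b1 c1 a2 b2 c2 + psi b0 b1 b2 c0 c1 c2 ≤
      2 * (kk a0 false a1 false b0 + kk a1 a0 a2 false b1 + kk b0 false b1 a0 c0
        + kk b1 b0 b2 a1 c1 + 2 * (1 - bi a0) + (1 - bi a1) + (1 - bi b0)) := by
  decide +kernel

theorem strip_lemma (a b c : ℕ → Bool) (n : ℕ)
    (h1 : ∀ j < n, 0 ≤ kk (a (j+1)) (a j) (a (j+2)) false (b (j+1)))
    (h2 : ∀ j < n, 0 ≤ kk (b (j+1)) (b j) (b (j+2)) (a (j+1)) (c (j+1))) :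
    psi (a n) (b n) (c n) (a (n+1)) (b (n+1)) (c (n+1))
      - psi (a 0) (b 0) (c 0) (a 1) (b 1) (c 1) + 2 * n ≤
    2 * ∑ j ∈ Finset.range n, sCost (a j) (b j) (c j) (a (j+1)) (b (j+1)) (c (j+1))
      (a (j+2)) (b (j+2)) (c (j+2)) := by
  induction n with
  | zero => simp
  | succ n ih =>
    have ih' := ih (fun j hj => h1 j (by omega)) (fun j hj => h2 j (by omega))
    have hs := step_lemma (a n) (b n) (c n) (a (n+1)) (b (n+1)) (c (n+1))
      (a (n+2)) (b (n+2)) (c (n+2)) (h1 n (by omega)) (h2 n (by omega))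
    rw [Finset.sum_range_succ]
    push_cast
    linarith

def pot3 : List ℤ :=
  [0, 0, 0, 0, 0, 0, 0, 0, 0, 0, 0, 0, 0, 0, 0, 0, 0, 0, 0, 0, 0, 0, 0, 0, -1, -1, -1, 0, -1, -1,
   -1, 0, 0, 0, 0, 0, 0, 0, 0, 0, -1, -1, -1, -1, -1, -1, -1, -1, -1, -1, -1, -1, -1, -1, 0, 0,
   -2, -1, 9, 9, -1, -1, 9, 9]

def psi3 (a b c a' b' c' : Bool) : ℤ := pot3.getD (code6 a b c a' b' c') 0

theorem step3 : ∀ a0 b0 c0 a1 b1 c1 a2 b2 c2 : Bool,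
    0 ≤ kk a1 a0 a2 false b1 → 0 ≤ kk b1 b0 b2 a1 c1 → 0 ≤ kk c1 c0 c2 b1 false →
    psi3 a1 b1 c1 a2 b2 c2 - psi3 a0 b0 c0 a1 b1 c1 ≤ 2 - (bi a1 + bi b1 + bi c1) := by
  decide +kernel

theorem start3 : ∀ a b c : Bool, psi3 false false false a b c = 0 := by decide +kernel

theorem end3 : ∀ a b c : Bool, -2 ≤ psi3 a b c false false false := by decide +kernel

theorem strip3 (a b c : ℕ → Bool) (n : ℕ)
    (h1 : ∀ j < n, 0 ≤ kk (a (j+1)) (a j) (a (j+2)) false (b (j+1)))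
    (h2 : ∀ j < n, 0 ≤ kk (b (j+1)) (b j) (b (j+2)) (a (j+1)) (c (j+1)))
    (h3 : ∀ j < n, 0 ≤ kk (c (j+1)) (c j) (c (j+2)) (b (j+1)) false) :
    ∑ j ∈ Finset.range n, (bi (a (j+1)) + bi (b (j+1)) + bi (c (j+1))) ≤
    2 * n + psi3 (a 0) (b 0) (c 0) (a 1) (b 1) (c 1)
     - psi3 (a n) (b n) (c n) (a (n+1)) (b (n+1)) (c (n+1)) := by
  induction n with
  | zero => simp
  | succ n ih =>
    have ih' := ih (fun j hj => h1 j (by omega)) (fun j hj => h2 j (by omega))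
      (fun j hj => h3 j (by omega))
    have hs := step3 (a n) (b n) (c n) (a (n+1)) (b (n+1)) (c (n+1))
      (a (n+2)) (b (n+2)) (c (n+2)) (h1 n (by omega)) (h2 n (by omega)) (h3 n (by omega))
    rw [Finset.sum_range_succ]
    push_cast
    linarith

/-- cost of the cell `(i+1, j+1)` -/
def kx (X : ℕ → ℕ → Bool) (i j : ℕ) : ℤ :=
  kk (X (i+1) (j+1)) (X (i+1) j) (X (i+1) (j+2)) (X i (j+1)) (X (i+2) (j+1))

/-- a grid of size `h × w` in padded coordinates -/
structure Good (h w : ℕ) (X : ℕ → ℕ → Bool) : Prop where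
  top : ∀ j, X 0 j = false
  bot : ∀ j, X (h+1) j = false
  left : ∀ i, X i 0 = false
  right : ∀ i, X i (w+1) = false
  deg : ∀ i < h, ∀ j < w, 0 ≤ kx X i j

theorem kk_swap (v l r u d : Bool) : kk v l r u d = kk v u d l r := by unfold kk; ring
theorem kk_ud (v l r u d : Bool) : kk v l r u d = kk v l r d u := by unfold kk; ring
theorem kk_lr (v l r u d : Bool) : kk v l r u d = kk v r l u d := by unfold kk; ring
theorem hh2_lr (v l r : Bool) : hh2 v l r = hh2 v r l := by unfold hh2; ring

theorem Good.transpose {h w : ℕ} {X : ℕ → ℕ → Bool} (H : Good h w X) :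
    Good w h (fun i j => X j i) := by
  refine ⟨H.left, H.right, H.top, H.bot, fun i hi j hj => ?_⟩
  have := H.deg j hj i hi
  unfold kx at *
  rwa [kk_swap]

def total (h w : ℕ) (X : ℕ → ℕ → Bool) : ℤ :=
  ∑ i ∈ Finset.range h, ∑ j ∈ Finset.range w, bi (X (i+1) (j+1))

theorem bound3 {w : ℕ} {X : ℕ → ℕ → Bool} (H : Good 3 w X) : total 3 w X ≤ 2 * w + 2 := by
  have h := strip3 (X 1) (X 2) (X 3) w
    (fun j hj => by simpa [kx, H.top] using H.deg 0 (by omega) j hj)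
    (fun j hj => by simpa [kx] using H.deg 1 (by omega) j hj)
    (fun j hj => by simpa [kx, H.bot 3] using
      (by have := H.deg 2 (by omega) j hj; simpa [kx, H.bot] using this))
  rw [H.left, H.left, H.left, H.right, H.right, H.right, start3] at h
  have h2 := end3 (X 1 w) (X 2 w) (X 3 w)
  have : total 3 w X = ∑ j ∈ Finset.range w, (bi (X 1 (j+1)) + bi (X 2 (j+1)) + bi (X 3 (j+1))) := by
    simp [total, Finset.sum_range_succ, Finset.sum_add_distrib]
  linarith

theorem total_transpose (h w : ℕ) (X : ℕ → ℕ → Bool) :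
    total h w X = total w h (fun i j => X j i) := by
  unfold total; rw [Finset.sum_comm]

theorem sum_shift_up (f : ℕ → ℤ) (n : ℕ) (h0 : f 0 = 0) :
    ∑ i ∈ Finset.range n, f i = ∑ i ∈ Finset.range n, f (i+1) - f n := by
  have := Finset.sum_range_succ f n
  rw [Finset.sum_range_succ'] at this
  linarith

theorem sum_shift_down (f : ℕ → ℤ) (n : ℕ) (h0 : f (n+1) = 0) :
    ∑ i ∈ Finset.range n, f (i+2) = ∑ i ∈ Finset.range n, f (i+1) - f 1 := by
  have := Finset.sum_range_succ (fun i => f (i+1)) n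
  rw [Finset.sum_range_succ'] at this
  simp only [zero_add, h0, add_assoc] at this
  norm_num at this
  linarith

theorem sum_kx {h w : ℕ} {X : ℕ → ℕ → Bool} (H : Good h w X) :
    ∑ i ∈ Finset.range h, ∑ j ∈ Finset.range w, kx X i j =
      4 * h * w - 6 * total h w X
      + ∑ j ∈ Finset.range w, (bi (X 1 (j+1)) + bi (X h (j+1)))
      + ∑ i ∈ Finset.range h, (bi (X (i+1) 1) + bi (X (i+1) w)) := by
  have f0 : bi false = 0 := rfl
  have e1 : ∑ i ∈ Finset.range h, ∑ j ∈ Finset.range w, bi (X (i+1) j) =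
      total h w X - ∑ i ∈ Finset.range h, bi (X (i+1) w) := by
    unfold total
    rw [← Finset.sum_sub_distrib]
    exact Finset.sum_congr rfl fun i _ => sum_shift_up (fun j => bi (X (i+1) j)) w (by simp [H.left, f0])
  have e2 : ∑ i ∈ Finset.range h, ∑ j ∈ Finset.range w, bi (X (i+1) (j+2)) =
      total h w X - ∑ i ∈ Finset.range h, bi (X (i+1) 1) := by
    unfold total
    rw [← Finset.sum_sub_distrib]
    exact Finset.sum_congr rfl fun i _ => sum_shift_down (fun j => bi (X (i+1) j)) w (by simp [H.right, f0])
  have e3 : ∑ i ∈ Finset.range h, ∑ j ∈ Finset.range w, bi (X i (j+1)) =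
      total h w X - ∑ j ∈ Finset.range w, bi (X h (j+1)) := by
    unfold total
    rw [Finset.sum_comm, Finset.sum_comm (s := Finset.range h), ← Finset.sum_sub_distrib]
    exact Finset.sum_congr rfl fun j _ => sum_shift_up (fun i => bi (X i (j+1))) h (by simp [H.top, f0])
  have e4 : ∑ i ∈ Finset.range h, ∑ j ∈ Finset.range w, bi (X (i+2) (j+1)) =
      total h w X - ∑ j ∈ Finset.range w, bi (X 1 (j+1)) := by
    unfold total
    rw [Finset.sum_comm, Finset.sum_comm (s := Finset.range h), ← Finset.sum_sub_distrib]
    exact Finset.sum_congr rfl fun j _ => sum_shift_down (fun i => bi (X i (j+1))) h (by simp [H.bot, f0])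
  simp only [kx, kk, Finset.sum_sub_distrib, Finset.sum_add_distrib, e1, e2, e3, e4,
    ← Finset.mul_sum, Finset.sum_const, Finset.card_range, nsmul_eq_mul]
  unfold total
  ring

theorem kk_ge : ∀ v l r u d : Bool, 0 ≤ kk v l r u d → hh2 v l r + hh2 v u d ≤ kk v l r u d := by
  decide +kernel

theorem hh2_nonneg : ∀ v l r : Bool, 0 ≤ hh2 v l r := by decide +kernel

theorem sum_split (f : ℕ → ℤ) (n : ℕ) : ∑ i ∈ Finset.range (n+4), f i =
    f 0 + f 1 + ∑ i ∈ Finset.range n, f (i+2) + f (n+2) + f (n+3) := by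
  rw [Finset.sum_range_succ, Finset.sum_range_succ, Finset.sum_range_succ', Finset.sum_range_succ']
  ring

theorem sum_ends (f : ℕ → ℤ) (n : ℕ) (hf : ∀ i, 0 ≤ f i) :
    f 0 + f (n+1) ≤ ∑ i ∈ Finset.range (n+2), f i := by
  rw [Finset.sum_range_succ, Finset.sum_range_succ']
  have : 0 ≤ ∑ i ∈ Finset.range n, f (i+1) := Finset.sum_nonneg fun i _ => hf _
  linarith

theorem kx_transpose (X : ℕ → ℕ → Bool) (i j : ℕ) :
    kx (fun i j => X j i) i j = kx X j i := by
  unfold kx; rw [kk_swap]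

theorem top_strip {m n : ℕ} {X : ℕ → ℕ → Bool} (H : Good (m+6) (n+6) X) :
    psi (X 1 (n+4)) (X 2 (n+4)) (X 3 (n+4)) (X 1 (n+5)) (X 2 (n+5)) (X 3 (n+5))
      - psi (X 1 2) (X 2 2) (X 3 2) (X 1 3) (X 2 3) (X 3 3) + 2 * (n + 2) ≤
    2 * (∑ j ∈ Finset.range (n+2), kx X 0 (j+2) + ∑ j ∈ Finset.range (n+2), kx X 1 (j+2)
      + ∑ j ∈ Finset.range (n+2), (1 - bi (X 1 (j+3)))
      + ∑ j ∈ Finset.range (n+2), hh2 (X 3 (j+3)) (X 3 (j+2)) (X 3 (j+4))) := by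
  have h := strip_lemma (fun j => X 1 (j+2)) (fun j => X 2 (j+2)) (fun j => X 3 (j+2)) (n+2)
    (fun j hj => by
      have := H.deg 0 (by omega) (j+2) (by omega)
      unfold kx at this
      rw [H.top] at this
      exact this)
    (fun j hj => H.deg 1 (by omega) (j+2) (by omega))
  have e : ∀ j, sCost (X 1 (j+2)) (X 2 (j+2)) (X 3 (j+2)) (X 1 (j+3)) (X 2 (j+3)) (X 3 (j+3))
      (X 1 (j+4)) (X 2 (j+4)) (X 3 (j+4)) = kx X 0 (j+2) + kx X 1 (j+2) + (1 - bi (X 1 (j+3)))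
       + hh2 (X 3 (j+3)) (X 3 (j+2)) (X 3 (j+4)) := by
    intro j
    unfold kx
    rw [H.top]
    rfl
  rw [← Finset.sum_add_distrib, ← Finset.sum_add_distrib, ← Finset.sum_add_distrib]
  rw [← Finset.sum_congr rfl fun j _ => e j]
  push_cast at h
  exact h

theorem bot_strip {m n : ℕ} {X : ℕ → ℕ → Bool} (H : Good (m+6) (n+6) X) :
    psi (X (m+6) (n+4)) (X (m+5) (n+4)) (X (m+4) (n+4))
        (X (m+6) (n+5)) (X (m+5) (n+5)) (X (m+4) (n+5))
      - psi (X (m+6) 2) (X (m+5) 2) (X (m+4) 2) (X (m+6) 3) (X (m+5) 3) (X (m+4) 3)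
      + 2 * (n + 2) ≤
    2 * (∑ j ∈ Finset.range (n+2), kx X (m+5) (j+2) + ∑ j ∈ Finset.range (n+2), kx X (m+4) (j+2)
      + ∑ j ∈ Finset.range (n+2), (1 - bi (X (m+6) (j+3)))
      + ∑ j ∈ Finset.range (n+2), hh2 (X (m+4) (j+3)) (X (m+4) (j+2)) (X (m+4) (j+4))) := by
  have h := strip_lemma (fun j => X (m+6) (j+2)) (fun j => X (m+5) (j+2))
    (fun j => X (m+4) (j+2)) (n+2)
    (fun j hj => by
      have := H.deg (m+5) (by omega) (j+2) (by omega)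
      unfold kx at this
      rw [H.bot, kk_ud] at this
      exact this)
    (fun j hj => by
      have := H.deg (m+4) (by omega) (j+2) (by omega)
      unfold kx at this
      rw [kk_ud] at this
      exact this)
  have e : ∀ j, sCost (X (m+6) (j+2)) (X (m+5) (j+2)) (X (m+4) (j+2))
      (X (m+6) (j+3)) (X (m+5) (j+3)) (X (m+4) (j+3))
      (X (m+6) (j+4)) (X (m+5) (j+4)) (X (m+4) (j+4)) =
      kx X (m+5) (j+2) + kx X (m+4) (j+2) + (1 - bi (X (m+6) (j+3)))
       + hh2 (X (m+4) (j+3)) (X (m+4) (j+2)) (X (m+4) (j+4)) := by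
    intro j
    unfold kx
    rw [H.bot, kk_ud _ _ _ _ false, kk_ud (X (m+4+1) _)]
    rfl
  rw [← Finset.sum_add_distrib, ← Finset.sum_add_distrib, ← Finset.sum_add_distrib]
  rw [← Finset.sum_congr rfl fun j _ => e j]
  push_cast at h
  exact h

theorem corner_tl {m n : ℕ} {X : ℕ → ℕ → Bool} (H : Good (m+6) (n+6) X) :
    2 + psi (X 1 2) (X 2 2) (X 3 2) (X 1 3) (X 2 3) (X 3 3)
      + psi (X 2 1) (X 2 2) (X 2 3) (X 3 1) (X 3 2) (X 3 3) ≤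
      2 * (kx X 0 0 + kx X 0 1 + kx X 1 0 + kx X 1 1
        + 2 * (1 - bi (X 1 1)) + (1 - bi (X 1 2)) + (1 - bi (X 2 1))) := by
  have e1 : kx X 0 0 = kk (X 1 1) false (X 1 2) false (X 2 1) := by
    unfold kx; rw [H.top, H.left]
  have e2 : kx X 0 1 = kk (X 1 2) (X 1 1) (X 1 3) false (X 2 2) := by
    unfold kx; rw [H.top]
  have e3 : kx X 1 0 = kk (X 2 1) false (X 2 2) (X 1 1) (X 3 1) := by
    unfold kx; rw [H.left]
  have e4 : kx X 1 1 = kk (X 2 2) (X 2 1) (X 2 3) (X 1 2) (X 3 2) := rfl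
  have d1 := H.deg 0 (by omega) 0 (by omega)
  have d2 := H.deg 0 (by omega) 1 (by omega)
  have d3 := H.deg 1 (by omega) 0 (by omega)
  have d4 := H.deg 1 (by omega) 1 (by omega)
  rw [e1] at *; rw [e2] at *; rw [e3] at *; rw [e4] at *
  exact corner_lemma _ _ _ _ _ _ _ _ _ d1 d2 d3 d4

theorem corner_tr {m n : ℕ} {X : ℕ → ℕ → Bool} (H : Good (m+6) (n+6) X) :
    2 + psi (X 1 (n+5)) (X 2 (n+5)) (X 3 (n+5)) (X 1 (n+4)) (X 2 (n+4)) (X 3 (n+4))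
      + psi (X 2 (n+6)) (X 2 (n+5)) (X 2 (n+4)) (X 3 (n+6)) (X 3 (n+5)) (X 3 (n+4)) ≤
      2 * (kx X 0 (n+5) + kx X 0 (n+4) + kx X 1 (n+5) + kx X 1 (n+4)
        + 2 * (1 - bi (X 1 (n+6))) + (1 - bi (X 1 (n+5))) + (1 - bi (X 2 (n+6)))) := by
  have e1 : kx X 0 (n+5) = kk (X 1 (n+6)) false (X 1 (n+5)) false (X 2 (n+6)) := by
    unfold kx; rw [H.top, H.right, kk_lr]
  have e2 : kx X 0 (n+4) = kk (X 1 (n+5)) (X 1 (n+6)) (X 1 (n+4)) false (X 2 (n+5)) := by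
    unfold kx; rw [H.top, kk_lr]
  have e3 : kx X 1 (n+5) = kk (X 2 (n+6)) false (X 2 (n+5)) (X 1 (n+6)) (X 3 (n+6)) := by
    unfold kx; rw [H.right, kk_lr]
  have e4 : kx X 1 (n+4) = kk (X 2 (n+5)) (X 2 (n+6)) (X 2 (n+4)) (X 1 (n+5)) (X 3 (n+5)) := by
    unfold kx; rw [kk_lr]
  have d1 := H.deg 0 (by omega) (n+5) (by omega)
  have d2 := H.deg 0 (by omega) (n+4) (by omega)
  have d3 := H.deg 1 (by omega) (n+5) (by omega)
  have d4 := H.deg 1 (by omega) (n+4) (by omega)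
  rw [e1] at *; rw [e2] at *; rw [e3] at *; rw [e4] at *
  exact corner_lemma _ _ _ _ _ _ _ _ _ d1 d2 d3 d4

theorem corner_br {m n : ℕ} {X : ℕ → ℕ → Bool} (H : Good (m+6) (n+6) X) :
    2 + psi (X (m+6) (n+5)) (X (m+5) (n+5)) (X (m+4) (n+5))
        (X (m+6) (n+4)) (X (m+5) (n+4)) (X (m+4) (n+4))
      + psi (X (m+5) (n+6)) (X (m+5) (n+5)) (X (m+5) (n+4))
        (X (m+4) (n+6)) (X (m+4) (n+5)) (X (m+4) (n+4)) ≤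
      2 * (kx X (m+5) (n+5) + kx X (m+5) (n+4) + kx X (m+4) (n+5) + kx X (m+4) (n+4)
        + 2 * (1 - bi (X (m+6) (n+6))) + (1 - bi (X (m+6) (n+5)))
        + (1 - bi (X (m+5) (n+6)))) := by
  have e1 : kx X (m+5) (n+5) = kk (X (m+6) (n+6)) false (X (m+6) (n+5)) false (X (m+5) (n+6)) := by
    unfold kx; rw [H.bot, H.right, kk_lr, kk_ud]
  have e2 : kx X (m+5) (n+4) =
      kk (X (m+6) (n+5)) (X (m+6) (n+6)) (X (m+6) (n+4)) false (X (m+5) (n+5)) := by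
    unfold kx; rw [H.bot, kk_lr, kk_ud]
  have e3 : kx X (m+4) (n+5) =
      kk (X (m+5) (n+6)) false (X (m+5) (n+5)) (X (m+6) (n+6)) (X (m+4) (n+6)) := by
    unfold kx; rw [H.right, kk_lr, kk_ud]
  have e4 : kx X (m+4) (n+4) =
      kk (X (m+5) (n+5)) (X (m+5) (n+6)) (X (m+5) (n+4)) (X (m+6) (n+5)) (X (m+4) (n+5)) := by
    unfold kx; rw [kk_lr, kk_ud]
  have d1 := H.deg (m+5) (by omega) (n+5) (by omega)
  have d2 := H.deg (m+5) (by omega) (n+4) (by omega)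
  have d3 := H.deg (m+4) (by omega) (n+5) (by omega)
  have d4 := H.deg (m+4) (by omega) (n+4) (by omega)
  rw [e1] at *; rw [e2] at *; rw [e3] at *; rw [e4] at *
  exact corner_lemma _ _ _ _ _ _ _ _ _ d1 d2 d3 d4

theorem corner_bl {m n : ℕ} {X : ℕ → ℕ → Bool} (H : Good (m+6) (n+6) X) :
    2 + psi (X (m+6) 2) (X (m+5) 2) (X (m+4) 2) (X (m+6) 3) (X (m+5) 3) (X (m+4) 3)
      + psi (X (m+5) 1) (X (m+5) 2) (X (m+5) 3) (X (m+4) 1) (X (m+4) 2) (X (m+4) 3) ≤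
      2 * (kx X (m+5) 0 + kx X (m+5) 1 + kx X (m+4) 0 + kx X (m+4) 1
        + 2 * (1 - bi (X (m+6) 1)) + (1 - bi (X (m+6) 2)) + (1 - bi (X (m+5) 1))) := by
  have e1 : kx X (m+5) 0 = kk (X (m+6) 1) false (X (m+6) 2) false (X (m+5) 1) := by
    unfold kx; rw [H.bot, H.left, kk_ud]
  have e2 : kx X (m+5) 1 = kk (X (m+6) 2) (X (m+6) 1) (X (m+6) 3) false (X (m+5) 2) := by
    unfold kx; rw [H.bot, kk_ud]
  have e3 : kx X (m+4) 0 = kk (X (m+5) 1) false (X (m+5) 2) (X (m+6) 1) (X (m+4) 1) := by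
    unfold kx; rw [H.left, kk_ud]
  have e4 : kx X (m+4) 1 = kk (X (m+5) 2) (X (m+5) 1) (X (m+5) 3) (X (m+6) 2) (X (m+4) 2) := by
    unfold kx; rw [kk_ud]
  have d1 := H.deg (m+5) (by omega) 0 (by omega)
  have d2 := H.deg (m+5) (by omega) 1 (by omega)
  have d3 := H.deg (m+4) (by omega) 0 (by omega)
  have d4 := H.deg (m+4) (by omega) 1 (by omega)
  rw [e1] at *; rw [e2] at *; rw [e3] at *; rw [e4] at *
  exact corner_lemma _ _ _ _ _ _ _ _ _ d1 d2 d3 d4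

theorem middle {m n : ℕ} {X : ℕ → ℕ → Bool} (H : Good (m+6) (n+6) X) :
    ∑ j ∈ Finset.range (n+2), hh2 (X 3 (j+3)) (X 3 (j+2)) (X 3 (j+4))
    + ∑ j ∈ Finset.range (n+2), hh2 (X (m+4) (j+3)) (X (m+4) (j+2)) (X (m+4) (j+4))
    + ∑ i ∈ Finset.range (m+2), hh2 (X (i+3) 3) (X (i+2) 3) (X (i+4) 3)
    + ∑ i ∈ Finset.range (m+2), hh2 (X (i+3) (n+4)) (X (i+2) (n+4)) (X (i+4) (n+4))
    ≤ ∑ i ∈ Finset.range (m+2), ∑ j ∈ Finset.range (n+2), kx X (i+2) (j+2) := by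
  have k : ∀ i ∈ Finset.range (m+2), ∀ j ∈ Finset.range (n+2),
      hh2 (X (i+3) (j+3)) (X (i+3) (j+2)) (X (i+3) (j+4))
      + hh2 (X (i+3) (j+3)) (X (i+2) (j+3)) (X (i+4) (j+3)) ≤ kx X (i+2) (j+2) := by
    intro i hi j hj
    rw [Finset.mem_range] at hi hj
    exact kk_ge _ _ _ _ _ (H.deg (i+2) (by omega) (j+2) (by omega))
  have h1 := Finset.sum_le_sum fun i hi => Finset.sum_le_sum (k i hi)
  simp only [Finset.sum_add_distrib] at h1
  have h2 := sum_ends (fun i => ∑ j ∈ Finset.range (n+2),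
    hh2 (X (i+3) (j+3)) (X (i+3) (j+2)) (X (i+3) (j+4))) m
    (fun i => Finset.sum_nonneg fun j _ => hh2_nonneg _ _ _)
  have h3 := sum_ends (fun j => ∑ i ∈ Finset.range (m+2),
    hh2 (X (i+3) (j+3)) (X (i+2) (j+3)) (X (i+4) (j+3))) n
    (fun i => Finset.sum_nonneg fun j _ => hh2_nonneg _ _ _)
  rw [Finset.sum_comm] at h3
  have h4 := add_le_add h2 h3
  refine le_trans (le_of_eq ?_) (h4.trans h1)
  simp only [zero_add, add_assoc]

theorem bound_big {m n : ℕ} {X : ℕ → ℕ → Bool} (H : Good (m+6) (n+6) X) :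
    6 * total (m+6) (n+6) X ≤ 4 * ((m+6 : ℕ) : ℤ) * ((n+6 : ℕ) : ℤ) + 12 := by
  have hk := sum_kx H
  have h1 := top_strip H
  have h2 := bot_strip H
  have h3 := top_strip H.transpose
  have h4 := bot_strip H.transpose
  simp only [kx_transpose] at h3 h4
  have c1 := corner_tl H
  have c2 := corner_tr H
  have c3 := corner_br H
  have c4 := corner_bl H
  have hm := middle H
  have a1 := psi_anti (X 1 (n+5)) (X 2 (n+5)) (X 3 (n+5)) (X 1 (n+4)) (X 2 (n+4)) (X 3 (n+4))
  have a2 := psi_anti (X (m+6) (n+5)) (X (m+5) (n+5)) (X (m+4) (n+5))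
        (X (m+6) (n+4)) (X (m+5) (n+4)) (X (m+4) (n+4))
  have a3 := psi_anti (X (m+5) (n+6)) (X (m+5) (n+5)) (X (m+5) (n+4))
        (X (m+4) (n+6)) (X (m+4) (n+5)) (X (m+4) (n+4))
  have a4 := psi_anti (X (m+5) 1) (X (m+5) 2) (X (m+5) 3) (X (m+4) 1) (X (m+4) 2) (X (m+4) 3)
  have s0 : ∀ f : ℕ → ℤ, ∀ n : ℕ, ∑ i ∈ Finset.range (n+6), f i =
    f 0 + f 1 + ∑ i ∈ Finset.range (n+2), f (i+2) + f (n+4) + f (n+5) :=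
    fun f n => sum_split f (n+2)
  simp only [s0, Finset.sum_add_distrib] at hk
  simp only [Finset.sum_sub_distrib, Finset.sum_const, Finset.card_range, nsmul_eq_mul] at h1 h2 h3 h4
  simp only [add_assoc, zero_add, Nat.reduceAdd] at *
  push_cast at *
  linarith

theorem main_bound {h w : ℕ} (hh : 3 ≤ h) (hw : 3 ≤ w) (h3 : h % 3 = 0) (w3 : w % 3 = 0)
    {X : ℕ → ℕ → Bool} (H : Good h w X) : 6 * total h w X ≤ 4 * (h : ℤ) * (w : ℤ) + 12 := by
  by_cases e : h = 3
  · subst e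
    have := bound3 H
    push_cast
    linarith
  by_cases e' : w = 3
  · subst e'
    have := bound3 H.transpose
    rw [total_transpose]
    push_cast
    linarith
  obtain ⟨m, rfl⟩ : ∃ m, h = m + 6 := ⟨h - 6, by omega⟩
  obtain ⟨n, rfl⟩ : ∃ n, w = n + 6 := ⟨w - 6, by omega⟩
  exact bound_big H

/-- extension of a word to padded coordinates -/
def ext {h w : ℕ} (W : Fin h × Fin w → Bool) (i j : ℕ) : Bool :=
  if hyp : (1 ≤ i ∧ i ≤ h) ∧ (1 ≤ j ∧ j ≤ w) then
    W (⟨i - 1, by omega⟩, ⟨j - 1, by omega⟩) else false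

theorem ext_in {h w : ℕ} (W : Fin h × Fin w → Bool) (i : Fin h) (j : Fin w) :
    ext W (i.val + 1) (j.val + 1) = W (i, j) := by
  unfold ext
  rw [dif_pos (by omega)]
  simp

theorem ext_true {h w : ℕ} (W : Fin h × Fin w → Bool) (i j : ℕ) (e : ext W i j = true) :
    ∃ q : Fin h × Fin w, W q = true ∧ q.1.val + 1 = i ∧ q.2.val + 1 = j := by
  unfold ext at e
  split at e
  · rename_i hyp
    exact ⟨_, e, by simp; omega, by simp; omega⟩
  · simp at e

theorem ext_deg {h w : ℕ} (W : Fin h × Fin w → Bool) (hdeg : degLEW W 2) (i : Fin h) (j : Fin w) :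
    0 ≤ kx (ext W) i j := by
  have hb : ∀ b, 0 ≤ bi b ∧ bi b ≤ 1 := by decide
  cases hv : W (i, j) with
  | false =>
    unfold kx kk
    rw [ext_in, hv]
    have e0 : bi false = 0 := rfl
    rw [e0]
    linarith [(hb (ext W (i+1) j)).2, (hb (ext W (i+1) (j+2))).2, (hb (ext W i (j+1))).2,
      (hb (ext W (i+2) (j+1))).2]
  | true =>
    have hd := hdeg (i, j) hv
    unfold degW at hd
    set S := Finset.univ.filter (fun q => cellAdj (i, j) q ∧ W q = true) with hS
    let N : Finset (ℕ × ℕ) := {(i.val+1, j.val), (i.val+1, j.val+2), (i.val, j.val+1), (i.val+2, j.val+1)}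
    have hsub : N.filter (fun p => ext W p.1 p.2 = true) ⊆
        S.image (fun q => (q.1.val + 1, q.2.val + 1)) := by
      rintro ⟨a, b⟩ hp
      rw [Finset.mem_filter] at hp
      obtain ⟨hN, he⟩ := hp
      obtain ⟨q, hq, rfl, rfl⟩ := ext_true W _ _ he
      refine Finset.mem_image.2 ⟨q, ?_, rfl⟩
      rw [hS, Finset.mem_filter]
      refine ⟨Finset.mem_univ _, ?_, hq⟩
      simp only [N, Finset.mem_insert, Finset.mem_singleton, Prod.mk.injEq] at hN
      simp only [cellAdj, Fin.ext_iff]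
      omega
    have hc := (Finset.card_le_card hsub).trans (Finset.card_image_le.trans hd)
    have hsum : ((N.filter (fun p => ext W p.1 p.2 = true)).card : ℤ) =
        bi (ext W (i+1) j) + bi (ext W (i+1) (j+2)) + bi (ext W i (j+1)) + bi (ext W (i+2) (j+1)) := by
      have hbi : ∀ b : Bool, (if b = true then (1:ℤ) else 0) = bi b := by decide
      rw [Finset.card_filter]
      push_cast
      simp only [hbi, N]
      rw [Finset.sum_insert (by simp), Finset.sum_insert (by simp), Finset.sum_insert (by simp),
        Finset.sum_singleton]
      ring
    unfold kx kk
    rw [ext_in, hv]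
    have e1 : bi true = 1 := rfl
    rw [e1]
    have : ((N.filter (fun p => ext W p.1 p.2 = true)).card : ℤ) ≤ 2 := by exact_mod_cast hc
    linarith

theorem ext_good {h w : ℕ} (W : Fin h × Fin w → Bool) (hdeg : degLEW W 2) : Good h w (ext W) := by
  refine ⟨?_, ?_, ?_, ?_, fun i hi j hj => ext_deg W hdeg ⟨i, hi⟩ ⟨j, hj⟩⟩ <;>
  · intro i
    unfold ext
    rw [dif_neg (by omega)]

theorem ext_total {h w : ℕ} (W : Fin h × Fin w → Bool) :
    (filledCount W : ℤ) = total h w (ext W) := by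
  have hbi : ∀ b : Bool, (if b = true then (1:ℤ) else 0) = bi b := by decide
  unfold filledCount total
  rw [Finset.card_filter]
  push_cast
  rw [Fintype.sum_prod_type, Finset.sum_range]
  refine Finset.sum_congr rfl fun i _ => ?_
  rw [Finset.sum_range]
  refine Finset.sum_congr rfl fun j _ => ?_
  rw [ext_in, hbi]

theorem stmt16 (h w : ℕ) (hh : 3 ≤ h) (hw : 3 ≤ w)
    (h3 : h % 3 = 0) (w3 : w % 3 = 0)
    (W : Fin h × Fin w → Bool) (hdeg : degLEW W 2) :
    filledCount W ≤ 2 * h * w / 3 + 2 := by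
  have hb := main_bound hh hw h3 w3 (ext_good W hdeg)
  rw [← ext_total] at hb
  have hb' : 6 * filledCount W ≤ 4 * (h * w) + 12 := by
    have : 4 * (h : ℤ) * (w : ℤ) = 4 * ((h : ℤ) * w) := by ring
    rw [this] at hb
    exact_mod_cast hb
  rw [mul_assoc]
  generalize h * w = P at *
  omega
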